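/- arXiv:2305.17893 — 2 statements merged into one kernel-verified Lean document; each statement's English description precedes it below -/
import Mathlib

section
/- Let (M_{n,t}, v_{n,t}, F_{n,t}) be a ladder system of abelian groups and let t_0 ≥ 0 be such that for every t ≥ t_0 and every n ≥ 2 the composite F_{n-1,t} ∘ v_{n,t} : M_{n,t} → M_{n-1,t} is surjective. Consider the tower (M_{n,0})_{n≥1} with transition maps ψ_{n-1,n} := F_{n-1,0} ∘ v_{n,0}, and composites ψ_{k,n} : M_{n,0} → M_{k,0}. Then for every k ≥ 1 and all n, m ≥ k + t_0 one has ψ_{k,n}(M_{n,0}) = ψ_{k,m}(M_{m,0}); indeed this common image equals the image of F_{k,0} ∘ F_{k,1} ∘ ⋯ ∘ F_{k,t_0-1} : M_{k,t_0} → M_{k,0}. In particular the tower (M_{n,0}) satisfies the Mittag–Leffler condition. -/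
/-- The composite transition map `ψ_{k, k+n} : M (k+n) →+ M k` of a tower. -/
def psiComp (M : ℕ → Type*) [∀ n, AddCommGroup (M n)]
    (ψ : ∀ n, M (n + 1) →+ M n) (k : ℕ) : ∀ n : ℕ, M (k + n) →+ M k
  | 0 => AddMonoidHom.id (M k)
  | n + 1 => (psiComp M ψ k n).comp (ψ (k + n))

/-- The Mittag--Leffler condition for a tower of abelian groups: for every `k` the
images of the composite transition maps into `M k` are eventually stable. -/
def IsMittagLeffler (M : ℕ → Type*) [∀ n, AddCommGroup (M n)]
    (ψ : ∀ n, M (n + 1) →+ M n) : Prop :=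
  ∀ k, ∃ N, ∀ n, N ≤ n → (psiComp M ψ k n).range = (psiComp M ψ k N).range

/-- The horizontal composite `F_{k,0} ∘ F_{k,1} ∘ ⋯ ∘ F_{k,d-1} : M k d →+ M k 0`
in a ladder system. -/
def Fcomp (M : ℕ → ℕ → Type*) [∀ n t, AddCommGroup (M n t)]
    (F : ∀ n t, M n (t + 1) →+ M n t) (k : ℕ) : ∀ d : ℕ, M k d →+ M k 0
  | 0 => AddMonoidHom.id (M k 0)
  | d + 1 => (Fcomp M F k d).comp (F k d)

theorem AddMonoidHom.range_comp_of_surjective {A B C : Type*} [AddGroup A] [AddGroup B]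
    [AddGroup C] (g : B →+ C) {f : A →+ B} (hf : Function.Surjective f) :
    (g.comp f).range = g.range := by
  rw [AddMonoidHom.range_comp, AddMonoidHom.range_eq_top.2 hf, ← AddMonoidHom.range_eq_map]

/-- The composite `M (k + d) t →+ M k s`, where `t + d = s`, of `d` consecutive maps `v` in a
ladder system. -/
def vComp (M : ℕ → ℕ → Type*) [∀ n t, AddCommGroup (M n t)]
    (v : ∀ n t, M (n + 1) t →+ M n (t + 1)) (k : ℕ) :
    ∀ d t s : ℕ, t + d = s → (M (k + d) t →+ M k s)
  | 0, t, _, h => h ▸ AddMonoidHom.id (M k t)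
  | d + 1, t, s, h => (vComp M v k d (t + 1) s (by omega)).comp (v (k + d) t)

section Ladder

variable {M : ℕ → ℕ → Type*} [∀ n t, AddCommGroup (M n t)]
  {v : ∀ n t, M (n + 1) t →+ M n (t + 1)} {F : ∀ n t, M n (t + 1) →+ M n t}

theorem vComp_surjective (hv : ∀ n t, Function.Surjective (v n t)) (k d t s : ℕ)
    (h : t + d = s) : Function.Surjective (vComp M v k d t s h) := by
  induction d generalizing t with
  | zero => subst h; exact Function.surjective_id
  | succ d ih => exact (ih (t + 1) (by omega)).comp (hv (k + d) t)

theorem vComp_comm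
    (hcomm : ∀ n t (x : M (n + 1) (t + 1)),
      v n t (F (n + 1) t x) = F n (t + 1) (v n (t + 1) x))
    (k d t s : ℕ) (h : t + d = s) (x : M (k + d) (t + 1)) :
    vComp M v k d t s h (F (k + d) t x) =
      F k s (vComp M v k d (t + 1) (s + 1) (by omega) x) := by
  induction d generalizing t with
  | zero => subst h; rfl
  | succ d ih =>
    exact (congrArg _ (hcomm (k + d) t x)).trans (ih (t + 1) (by omega) (v (k + d) (t + 1) x))

theorem psiComp_eq_Fcomp_comp_vComp
    (hcomm : ∀ n t (x : M (n + 1) (t + 1)),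
      v n t (F (n + 1) t x) = F n (t + 1) (v n (t + 1) x))
    (k d : ℕ) :
    psiComp (fun n => M n 0) (fun n => (F n 0).comp (v n 0)) k d =
      (Fcomp M F k d).comp (vComp M v k d 0 d (Nat.zero_add d)) := by
  induction d with
  | zero => rfl
  | succ d ih =>
    ext x
    exact (DFunLike.congr_fun ih _).trans
      (congrArg (Fcomp M F k d) (vComp_comm hcomm k d 0 d (Nat.zero_add d) (v (k + d) 0 x)))

theorem range_psiComp_eq_range_Fcomp (hv : ∀ n t, Function.Surjective (v n t))
    (hcomm : ∀ n t (x : M (n + 1) (t + 1)),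
      v n t (F (n + 1) t x) = F n (t + 1) (v n (t + 1) x))
    (k d : ℕ) :
    (psiComp (fun n => M n 0) (fun n => (F n 0).comp (v n 0)) k d).range =
      (Fcomp M F k d).range := by
  rw [psiComp_eq_Fcomp_comp_vComp hcomm]
  exact AddMonoidHom.range_comp_of_surjective _ (vComp_surjective hv k d 0 d _)

theorem range_Fcomp_eq_of_surjective {k t₀ : ℕ}
    (hF : ∀ t, t₀ ≤ t → Function.Surjective (F k t)) {d : ℕ} (hd : t₀ ≤ d) :
    (Fcomp M F k d).range = (Fcomp M F k t₀).range := by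
  induction d, hd using Nat.le_induction with
  | base => rfl
  | succ d hd ih => exact (AddMonoidHom.range_comp_of_surjective _ (hF d hd)).trans ih

end Ladder

/-- for a ladder system of abelian groups (levels `n` indexed from `0`,
corresponding to the paper's `n ≥ 1`; `v` surjective; commuting squares) such that
for every `t ≥ t₀` the diagonal composites `F ∘ v : M (n+1) t →+ M n t` are
surjective, the tower `(M n 0)` with transition maps `ψ n := F n 0 ∘ v n 0` is
eventually stable: for every `k` and every offset `d ≥ t₀` (i.e. tower indices
`n ≥ k + t₀`), the image of `ψ_{k,k+d}` equals the image of the horizontal composite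
`F_{k,0} ∘ ⋯ ∘ F_{k,t₀-1} : M k t₀ →+ M k 0` — in particular all these images agree —
and hence the tower satisfies the Mittag--Leffler condition. -/
theorem stmt4 (M : ℕ → ℕ → Type*) [∀ n t, AddCommGroup (M n t)]
    (v : ∀ n t, M (n + 1) t →+ M n (t + 1))
    (F : ∀ n t, M n (t + 1) →+ M n t)
    (hv : ∀ n t, Function.Surjective (v n t))
    (hcomm : ∀ n t (x : M (n + 1) (t + 1)),
      v n t (F (n + 1) t x) = F n (t + 1) (v n (t + 1) x))
    (t₀ : ℕ)
    (hFv : ∀ t, t₀ ≤ t → ∀ n, Function.Surjective ((F n t).comp (v n t))) :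
    (∀ k d, t₀ ≤ d →
      (psiComp (fun n => M n 0) (fun n => (F n 0).comp (v n 0)) k d).range
        = (Fcomp M F k t₀).range) ∧
    IsMittagLeffler (fun n => M n 0) (fun n => (F n 0).comp (v n 0)) := by
  have key : ∀ k d, t₀ ≤ d →
      (psiComp (fun n => M n 0) (fun n => (F n 0).comp (v n 0)) k d).range
        = (Fcomp M F k t₀).range := fun k d hd =>
    (range_psiComp_eq_range_Fcomp hv hcomm k d).trans
      (range_Fcomp_eq_of_surjective
        (fun t ht => Function.Surjective.of_comp (g := v k t) (hFv t ht k)) hd)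
  exact ⟨key, fun k => ⟨t₀, fun n hn => (key k n hn).trans (key k t₀ le_rfl).symm⟩⟩
end

section
/- Let (M_{n,t}, v_{n,t}, F_{n,t}) be a ladder system of abelian groups and let t_0 ≥ 0 be such that for every t ≥ t_0 and every n ≥ 2 the composite F_{n-1,t} ∘ v_{n,t} : M_{n,t} → M_{n-1,t} is surjective. Let (M_{n,0})_{n≥1} be the tower with transition maps ψ_{n-1,n} := F_{n-1,0} ∘ v_{n,0}. Then for any towers of abelian groups (B_n)_{n≥1} and (C_n)_{n≥1} and morphisms of towers i_n : M_{n,0} → B_n and q_n : B_n → C_n commuting with all transition maps such that each sequence 0 → M_{n,0} → B_n → C_n → 0 is exact, the induced map on inverse limits lim_n B_n → lim_n C_n is surjective. -/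
/-- The inverse limit of a tower of abelian groups `(M n)` with transition maps
`ψ n : M (n+1) →+ M n`: compatible families. -/
def TowerLim (M : ℕ → Type*) [∀ n, AddCommGroup (M n)]
    (ψ : ∀ n, M (n + 1) →+ M n) : Type _ :=
  { x : ∀ n, M n // ∀ n, ψ n (x (n + 1)) = x n }

/-- Vanishing of `lim¹` of a tower: the map `x ↦ (x n - ψ n (x (n + 1)))ₙ` on the product of
its terms is surjective. -/
def LimOneVanishes (A : ℕ → Type*) [∀ n, AddCommGroup (A n)]
    (ψ : ∀ n, A (n + 1) →+ A n) : Prop :=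
  ∀ a : ∀ n, A n, ∃ x : ∀ n, A n, ∀ n, x n - ψ n (x (n + 1)) = a n

theorem LimOneVanishes.of_surjective {A : ℕ → Type*} [∀ n, AddCommGroup (A n)]
    {ψ : ∀ n, A (n + 1) →+ A n} (hψ : ∀ n, Function.Surjective (ψ n)) :
    LimOneVanishes A ψ := by
  intro a
  choose s hs using hψ
  refine ⟨fun n => Nat.rec 0 (fun n x => s n (x - a n)) n, fun n => ?_⟩
  simp [hs]

/-- Vanishing of `lim¹` passes between the two towers obtained from an interleaved tower
`⋯ → A (n + 1) → A' n → A n → ⋯`. -/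
theorem LimOneVanishes.of_interleaved {A A' : ℕ → Type*} [∀ n, AddCommGroup (A n)]
    [∀ n, AddCommGroup (A' n)] (u : ∀ n, A (n + 1) →+ A' n) (f : ∀ n, A' n →+ A n)
    (h : LimOneVanishes A' fun n => (u n).comp (f (n + 1))) :
    LimOneVanishes A fun n => (f n).comp (u n) := by
  intro a
  obtain ⟨y, hy⟩ := h fun n => u n (a (n + 1))
  refine ⟨fun n => a n + f n (y n), fun n => ?_⟩
  have key := congrArg (f n) (hy n)
  simp only [AddMonoidHom.comp_apply, map_sub, map_add] at key ⊢
  rw [← key]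
  abel

/-- If the kernel tower of a short exact sequence of towers has vanishing `lim¹`, then every
compatible family in the quotient tower lifts to a compatible family. -/
theorem LimOneVanishes.exists_compatible_lift {A B C : ℕ → Type*} [∀ n, AddCommGroup (A n)]
    [∀ n, AddCommGroup (B n)] [∀ n, AddCommGroup (C n)]
    {ψA : ∀ n, A (n + 1) →+ A n} {ψB : ∀ n, B (n + 1) →+ B n} {ψC : ∀ n, C (n + 1) →+ C n}
    {i : ∀ n, A n →+ B n} {q : ∀ n, B n →+ C n} (hA : LimOneVanishes A ψA)
    (hi : ∀ n a, i n (ψA n a) = ψB n (i (n + 1) a))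
    (hq : ∀ n b, q n (ψB n b) = ψC n (q (n + 1) b))
    (hex : ∀ n, (i n).range = (q n).ker) (hsurj : ∀ n, Function.Surjective (q n))
    (c : ∀ n, C n) (hc : ∀ n, ψC n (c (n + 1)) = c n) :
    ∃ b : ∀ n, B n, (∀ n, ψB n (b (n + 1)) = b n) ∧ ∀ n, q n (b n) = c n := by
  choose b hb using fun n => hsurj n (c n)
  have hdiff : ∀ n, ∃ a, i n a = ψB n (b (n + 1)) - b n := fun n => by
    rw [← AddMonoidHom.mem_range, hex, AddMonoidHom.mem_ker, map_sub, hq, hb, hb, hc, sub_self]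
  choose a ha using hdiff
  obtain ⟨x, hx⟩ := hA a
  refine ⟨fun n => b n + i n (x n), fun n => ?_, fun n => ?_⟩
  · have key := congrArg (i n) (hx n)
    rw [map_sub, hi, ha] at key
    simp only [map_add, eq_add_of_sub_eq key]
    abel
  · have hqi : q n (i n (x n)) = 0 := by
      rw [← AddMonoidHom.mem_ker, ← hex]
      exact ⟨x n, rfl⟩
    rw [map_add, hqi, add_zero, hb]

/-- In a ladder system whose columns eventually have surjective transition maps, every column
has vanishing `lim¹`. -/
theorem limOneVanishes_ladder {M : ℕ → ℕ → Type*} [∀ n t, AddCommGroup (M n t)]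
    (v : ∀ n t, M (n + 1) t →+ M n (t + 1)) (F : ∀ n t, M n (t + 1) →+ M n t)
    (hcomm : ∀ n t (x : M (n + 1) (t + 1)),
      v n t (F (n + 1) t x) = F n (t + 1) (v n (t + 1) x))
    (t₀ : ℕ) (hFv : ∀ t, t₀ ≤ t → ∀ n, Function.Surjective ((F n t).comp (v n t))) (t : ℕ) :
    LimOneVanishes (fun n => M n t) fun n => (F n t).comp (v n t) := by
  rcases le_total t₀ t with ht | ht
  · exact .of_surjective (hFv t ht)
  · induction ht using Nat.decreasingInduction with
    | self => exact .of_surjective (hFv t₀ le_rfl)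
    | of_succ t _ ih =>
      refine .of_interleaved (fun n => v n t) (fun n => F n t) ?_
      have hswap : ∀ n, (v n t).comp (F (n + 1) t) = (F n (t + 1)).comp (v n (t + 1)) :=
        fun n => AddMonoidHom.ext (hcomm n t)
      simpa only [hswap] using ih

/-- let `M n t` be a ladder system of abelian groups (levels `n`
indexed from `0`, corresponding to the paper's `n ≥ 1`; `v` surjective; commuting
squares) such that for every `t ≥ t₀` the diagonal composites
`F ∘ v : M (n+1) t →+ M n t` are surjective, and consider the tower `(M n 0)` with
transition maps `ψ n := F n 0 ∘ v n 0`.  Then for any towers `(B n)`, `(C n)` and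
morphisms of towers `i n : M n 0 →+ B n`, `q n : B n →+ C n` commuting with all
transition maps, such that every sequence `0 → M n 0 → B n → C n → 0` is exact,
the induced map on inverse limits `lim B_n → lim C_n` is surjective. -/
theorem stmt5 (M : ℕ → ℕ → Type*) [∀ n t, AddCommGroup (M n t)]
    (v : ∀ n t, M (n + 1) t →+ M n (t + 1))
    (F : ∀ n t, M n (t + 1) →+ M n t)
    (hv : ∀ n t, Function.Surjective (v n t))
    (hcomm : ∀ n t (x : M (n + 1) (t + 1)),
      v n t (F (n + 1) t x) = F n (t + 1) (v n (t + 1) x))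
    (t₀ : ℕ)
    (hFv : ∀ t, t₀ ≤ t → ∀ n, Function.Surjective ((F n t).comp (v n t)))
    (B C : ℕ → Type*) [∀ n, AddCommGroup (B n)] [∀ n, AddCommGroup (C n)]
    (ψB : ∀ n, B (n + 1) →+ B n) (ψC : ∀ n, C (n + 1) →+ C n)
    (i : ∀ n, M n 0 →+ B n) (q : ∀ n, B n →+ C n)
    (hi : ∀ n (a : M (n + 1) 0), i n ((F n 0).comp (v n 0) a) = ψB n (i (n + 1) a))
    (hq : ∀ n (b : B (n + 1)), q n (ψB n b) = ψC n (q (n + 1) b))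
    (hinj : ∀ n, Function.Injective (i n))
    (hex : ∀ n, (i n).range = (q n).ker)
    (hsurj : ∀ n, Function.Surjective (q n)) :
    Function.Surjective (fun b : TowerLim B ψB =>
      (⟨fun n => q n (b.1 n), fun n => by rw [← hq, b.2 n]⟩ : TowerLim C ψC)) := by
  rintro ⟨c, hc⟩
  obtain ⟨b, hb, hbc⟩ :=
    (limOneVanishes_ladder v F hcomm t₀ hFv 0).exists_compatible_lift hi hq hex hsurj c hc
  exact ⟨⟨b, hb⟩, Subtype.ext (funext hbc)⟩
end
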